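/- arXiv:2210.00184 — 2 statements merged into one kernel-verified Lean document; each statement's English description precedes it below -/
import Mathlib

section
/- Let γ ≥ 0 and b ≥ 0. Let E₁,…,Eₙ, H₁,…,Hₙ, H̃₁,…,H̃ₙ, Δ₁,…,Δₙ be d×d real matrices with sqrt(Σᵢ ‖Δᵢ‖_F²) ≤ b. Define, for each i: H̃'ᵢ = H̃ᵢ + Q(Hᵢ − H̃ᵢ); Ĥᵢ = H̃ᵢ + Q(Eᵢ + Hᵢ − H̃ᵢ); H'ᵢ = Hᵢ − γ(Ĥᵢ − Σⱼ Wᵢⱼ Ĥⱼ) + Δᵢ. Then, with H̄ = (1/n)Σⱼ Hⱼ: sqrt(Σᵢ ‖H'ᵢ − H̃'ᵢ‖_F²) ≤ (1 − δ + 2γ(1 − δ)) · sqrt(Σᵢ ‖Hᵢ − H̃ᵢ‖_F²) + 4γ · sqrt(Σᵢ ‖Eᵢ‖_F²) + 2γ · sqrt(Σᵢ ‖Hᵢ − H̄‖_F²) + b. -/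
/-- Frobenius norm of a `d × d` real matrix. -/
noncomputable def frob {d : ℕ} (X : Matrix (Fin d) (Fin d) ℝ) : ℝ :=
  Real.sqrt (∑ i, ∑ j, (X i j) ^ 2)

section GeneralNorm

variable {ι V : Type*} [Fintype ι] [NormedAddCommGroup V]

/-- The `ℓ²` aggregate of the norms of a finite family of vectors. -/
noncomputable def l2Norm (x : ι → V) : ℝ :=
  Real.sqrt (∑ i, ‖x i‖ ^ 2)

theorem l2Norm_eq_norm_toLp (x : ι → V) : l2Norm x = ‖WithLp.toLp 2 x‖ :=
  (PiLp.norm_eq_of_L2 (WithLp.toLp 2 x)).symm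

theorem l2Norm_add_le (x y : ι → V) : l2Norm (x + y) ≤ l2Norm x + l2Norm y := by
  simp only [l2Norm_eq_norm_toLp, WithLp.toLp_add]
  exact norm_add_le _ _

theorem l2Norm_sub_le (x y : ι → V) : l2Norm (x - y) ≤ l2Norm x + l2Norm y := by
  simp only [l2Norm_eq_norm_toLp, WithLp.toLp_sub]
  exact norm_sub_le _ _

theorem l2Norm_le_mul_of_norm_le {x y : ι → V} {c : ℝ} (hc : 0 ≤ c)
    (h : ∀ i, ‖x i‖ ≤ c * ‖y i‖) : l2Norm x ≤ c * l2Norm y := by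
  refine Real.sqrt_le_iff.2 ⟨mul_nonneg hc (Real.sqrt_nonneg _), ?_⟩
  rw [mul_pow, l2Norm, Real.sq_sqrt (by positivity), Finset.mul_sum]
  refine Finset.sum_le_sum fun i _ => ?_
  rw [← mul_pow]
  exact pow_le_pow_left₀ (norm_nonneg _) (h i) 2

variable [NormedSpace ℝ V]

/-- Averaging with a doubly stochastic matrix does not increase the `ℓ²` aggregate. -/
theorem l2Norm_sum_smul_le {W : Matrix ι ι ℝ} (hnonneg : ∀ i j, 0 ≤ W i j)
    (hrow : ∀ i, ∑ j, W i j = 1) (hcol : ∀ j, ∑ i, W i j = 1) (x : ι → V) :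
    l2Norm (fun i => ∑ j, W i j • x j) ≤ l2Norm x := by
  refine Real.sqrt_le_sqrt ?_
  calc ∑ i, ‖∑ j, W i j • x j‖ ^ 2
      ≤ ∑ i, ∑ j, W i j * ‖x j‖ ^ 2 := by
        refine Finset.sum_le_sum fun i _ => ?_
        have htri : ‖∑ j, W i j • x j‖ ≤ ∑ j, W i j * ‖x j‖ :=
          norm_sum_le_of_le _ fun j _ => by
            rw [norm_smul, Real.norm_of_nonneg (hnonneg i j)]
        exact (pow_le_pow_left₀ (norm_nonneg _) htri 2).trans
          (Real.pow_arith_mean_le_arith_mean_pow _ _ _ (fun j _ => hnonneg i j) (hrow i)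
            (fun j _ => norm_nonneg _) 2)
    _ = ∑ j, ‖x j‖ ^ 2 := by
        rw [Finset.sum_comm]
        simp only [← Finset.sum_mul, hcol, one_mul]

/-- For a doubly stochastic `W`, the operator `1 - W` at most doubles the distance to any constant
family. -/
theorem l2Norm_sub_sum_smul_le {W : Matrix ι ι ℝ} (hnonneg : ∀ i j, 0 ≤ W i j)
    (hrow : ∀ i, ∑ j, W i j = 1) (hcol : ∀ j, ∑ i, W i j = 1) (x : ι → V) (c : V) :
    l2Norm (fun i => x i - ∑ j, W i j • x j) ≤ 2 * l2Norm (fun i => x i - c) := by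
  have hshift : (fun i => x i - ∑ j, W i j • x j) =
      (fun i => x i - c) - fun i => ∑ j, W i j • (x j - c) := by
    funext i
    simp [smul_sub, Finset.sum_sub_distrib, ← Finset.sum_smul, hrow]
  rw [hshift, two_mul]
  exact (l2Norm_sub_le _ _).trans
    (add_le_add_right (l2Norm_sum_smul_le hnonneg hrow hcol fun i => x i - c) _)

/-- One step of compressed gossip, in an arbitrary normed space and around an arbitrary centre. -/
theorem l2Norm_compressed_gossip_le {W : Matrix ι ι ℝ} (hnonneg : ∀ i j, 0 ≤ W i j)
    (hrow : ∀ i, ∑ j, W i j = 1) (hcol : ∀ j, ∑ i, W i j = 1) {γ δ : ℝ} (hγ : 0 ≤ γ)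
    (hδ0 : 0 ≤ δ) (hδ1 : δ ≤ 1) {Q : V → V} (hQ : ∀ a, ‖Q a - a‖ ≤ (1 - δ) * ‖a‖)
    (e h t D y : ι → V) (hy : ∀ i, y i = t i + Q (e i + h i - t i)) (c : V) :
    l2Norm (fun i => h i - γ • (y i - ∑ j, W i j • y j) + D i - (t i + Q (h i - t i))) ≤
      (1 - δ + 2 * γ * (1 - δ)) * l2Norm (fun i => h i - t i) + 4 * γ * l2Norm e
        + 2 * γ * l2Norm (fun i => h i - c) + l2Norm D := by
  have hδ : 0 ≤ 1 - δ := sub_nonneg.2 hδ1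
  have hcompress (a : ι → V) : l2Norm (fun i => Q (a i) - a i) ≤ (1 - δ) * l2Norm a :=
    l2Norm_le_mul_of_norm_le hδ fun i => hQ (a i)
  have hcentre : l2Norm (fun i => y i - c) ≤
      (1 - δ) * l2Norm (fun i => h i - t i) + 2 * l2Norm e + l2Norm (fun i => h i - c) := by
    have hsplit : (fun i => y i - c) =
        (fun i => Q ((e + fun i => h i - t i) i) - (e + fun i => h i - t i) i) + e
          + fun i => h i - c := by
      funext i
      simp only [Pi.add_apply, hy, add_sub_assoc]
      abel
    rw [hsplit]
    have hδe : 0 ≤ δ * l2Norm e := mul_nonneg hδ0 (Real.sqrt_nonneg _)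
    have hres := hcompress (e + fun i => h i - t i)
    have htri := mul_le_mul_of_nonneg_left (l2Norm_add_le e fun i => h i - t i) hδ
    refine (l2Norm_add_le _ _).trans (add_le_add_left ((l2Norm_add_le _ _).trans ?_) _)
    linarith
  have hgossip : l2Norm (fun i => γ • (y i - ∑ j, W i j • y j)) ≤
      γ * (2 * l2Norm (fun i => y i - c)) :=
    (l2Norm_le_mul_of_norm_le hγ fun i => by rw [norm_smul, Real.norm_of_nonneg hγ]).trans
      (mul_le_mul_of_nonneg_left (l2Norm_sub_sum_smul_le hnonneg hrow hcol y c) hγ)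
  have hsplit : (fun i => h i - γ • (y i - ∑ j, W i j • y j) + D i - (t i + Q (h i - t i))) =
      D - (fun i => Q (h i - t i) - (h i - t i)) - fun i => γ • (y i - ∑ j, W i j • y j) := by
    funext i
    simp only [Pi.sub_apply]
    abel
  rw [hsplit]
  have hres := hcompress fun i => h i - t i
  have htri := l2Norm_sub_le D fun i => Q (h i - t i) - (h i - t i)
  have hscaled := mul_le_mul_of_nonneg_left hcentre hγ
  refine (l2Norm_sub_le _ _).trans ?_
  linarith

end GeneralNorm

open scoped Matrix.Norms.Frobenius in
theorem frob_eq_norm {d : ℕ} (X : Matrix (Fin d) (Fin d) ℝ) : frob X = ‖X‖ := by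
  simp [frob, Matrix.frobenius_norm_def, Real.sqrt_eq_rpow]

open scoped Matrix.Norms.Frobenius in
/-- Lemma 7: recursion for the difference between the Hessian approximation
and its compressed counterpart. With `H̃'ᵢ = H̃ᵢ + Q(Hᵢ - H̃ᵢ)`,
`Ĥᵢ = H̃ᵢ + Q(Eᵢ + Hᵢ - H̃ᵢ)` and `H'ᵢ = Hᵢ - γ(Ĥᵢ - ∑ⱼ Wᵢⱼ Ĥⱼ) + Δᵢ`,
`√(∑ᵢ‖H'ᵢ - H̃'ᵢ‖_F²) ≤ (1 - δ + 2γ(1-δ)) √(∑ᵢ‖Hᵢ - H̃ᵢ‖_F²)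
  + 4γ √(∑ᵢ‖Eᵢ‖_F²) + 2γ √(∑ᵢ‖Hᵢ - H̄‖_F²) + b`. -/
theorem stmt_9 (n d : ℕ) (hn : 1 ≤ n) (γ b δ : ℝ)
    (hγ : 0 ≤ γ) (hb : 0 ≤ b) (hδ0 : 0 < δ) (hδ1 : δ ≤ 1)
    (W : Matrix (Fin n) (Fin n) ℝ)
    (hWnn : ∀ i j, 0 ≤ W i j) (hWsymm : W.IsSymm) (hWrow : ∀ i, ∑ j, W i j = 1)
    (Q : Matrix (Fin d) (Fin d) ℝ → Matrix (Fin d) (Fin d) ℝ)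
    (hQ : ∀ A, frob (Q A - A) ≤ (1 - δ) * frob A)
    (E H Ht Δ Ht' Hhat H' : Fin n → Matrix (Fin d) (Fin d) ℝ)
    (hΔ : Real.sqrt (∑ i, (frob (Δ i)) ^ 2) ≤ b)
    (hHt' : ∀ i, Ht' i = Ht i + Q (H i - Ht i))
    (hHhat : ∀ i, Hhat i = Ht i + Q (E i + H i - Ht i))
    (hH' : ∀ i, H' i = H i - γ • (Hhat i - ∑ j, W i j • Hhat j) + Δ i)
    (Hbar : Matrix (Fin d) (Fin d) ℝ) (hHbar : Hbar = (n : ℝ)⁻¹ • ∑ j, H j) :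
    Real.sqrt (∑ i, (frob (H' i - Ht' i)) ^ 2) ≤
      (1 - δ + 2 * γ * (1 - δ)) * Real.sqrt (∑ i, (frob (H i - Ht i)) ^ 2)
        + 4 * γ * Real.sqrt (∑ i, (frob (E i)) ^ 2)
        + 2 * γ * Real.sqrt (∑ i, (frob (H i - Hbar)) ^ 2) + b := by
  have hcol : ∀ j, ∑ i, W i j = 1 := fun j => by
    simpa only [hWsymm.apply] using hWrow j
  simp only [frob_eq_norm] at hQ hΔ ⊢
  simp only [hH', hHt']
  exact (l2Norm_compressed_gossip_le hWnn hWrow hcol hγ hδ0.le hδ1 hQ E H Ht Δ Hhat hHhat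
    Hbar).trans (add_le_add_right hΔ _)
end

section
/- Let 0 ≤ γ ≤ 1 and b ≥ 0, and assume 0 ≤ σ. Let E₁,…,Eₙ, H₁,…,Hₙ, H̃₁,…,H̃ₙ, Δ₁,…,Δₙ be d×d real matrices with sqrt(Σᵢ ‖Δᵢ‖_F²) ≤ b. Define, for each i: Ĥᵢ = H̃ᵢ + Q(Eᵢ + Hᵢ − H̃ᵢ); H'ᵢ = Hᵢ − γ(Ĥᵢ − Σⱼ Wᵢⱼ Ĥⱼ) + Δᵢ. Then, with H̄ = (1/n)Σⱼ Hⱼ and H̄' = (1/n)Σⱼ H'ⱼ: sqrt(Σᵢ ‖H'ᵢ − H̄'‖_F²) ≤ (1 − γ(1 − σ)) · sqrt(Σᵢ ‖Hᵢ − H̄‖_F²) + 4γ · sqrt(Σᵢ ‖Eᵢ‖_F²) + 2γ(1 − δ) · sqrt(Σᵢ ‖Hᵢ − H̃ᵢ‖_F²) + b. -/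
open Finset

/-- Frobenius norm of a finite family of matrices. -/
noncomputable def familyNorm {n d : ℕ} (X : Fin n → Matrix (Fin d) (Fin d) ℝ) : ℝ :=
  Real.sqrt (∑ i, (frob (X i)) ^ 2)

/-- The weighted sums `∑ j, M i j • X j` of a family of matrices. -/
def mix {n d : ℕ} (M : Matrix (Fin n) (Fin n) ℝ) (X : Fin n → Matrix (Fin d) (Fin d) ℝ) :
    Fin n → Matrix (Fin d) (Fin d) ℝ :=
  fun i => ∑ j, M i j • X j

/-- The entries of a family of matrices as one Euclidean vector. -/
noncomputable def flatten {n d : ℕ} (X : Fin n → Matrix (Fin d) (Fin d) ℝ) :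
    EuclideanSpace ℝ (Fin n × Fin d × Fin d) :=
  WithLp.toLp 2 fun p => X p.1 p.2.1 p.2.2

section

variable {n d : ℕ}

lemma frob_nonneg (A : Matrix (Fin d) (Fin d) ℝ) : 0 ≤ frob A :=
  Real.sqrt_nonneg _

lemma frob_sq (A : Matrix (Fin d) (Fin d) ℝ) : frob A ^ 2 = ∑ k, ∑ l, A k l ^ 2 :=
  Real.sq_sqrt (by positivity)

lemma familyNorm_nonneg (X : Fin n → Matrix (Fin d) (Fin d) ℝ) : 0 ≤ familyNorm X :=
  Real.sqrt_nonneg _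

lemma familyNorm_eq_norm_flatten (X : Fin n → Matrix (Fin d) (Fin d) ℝ) :
    familyNorm X = ‖flatten X‖ := by
  simp [familyNorm, flatten, EuclideanSpace.norm_eq, frob_sq, Fintype.sum_prod_type]

lemma familyNorm_add_le (X Y : Fin n → Matrix (Fin d) (Fin d) ℝ) :
    familyNorm (X + Y) ≤ familyNorm X + familyNorm Y := by
  simp only [familyNorm_eq_norm_flatten]
  exact norm_add_le (flatten X) (flatten Y)

lemma familyNorm_sub_le (X Y : Fin n → Matrix (Fin d) (Fin d) ℝ) :
    familyNorm (X - Y) ≤ familyNorm X + familyNorm Y := by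
  simp only [familyNorm_eq_norm_flatten]
  exact norm_sub_le (flatten X) (flatten Y)

lemma familyNorm_smul {c : ℝ} (hc : 0 ≤ c) (X : Fin n → Matrix (Fin d) (Fin d) ℝ) :
    familyNorm (c • X) = c * familyNorm X := by
  simp only [familyNorm_eq_norm_flatten]
  exact norm_smul_of_nonneg hc (flatten X)

lemma familyNorm_le_of_frob_le {c : ℝ} (hc : 0 ≤ c) {X Y : Fin n → Matrix (Fin d) (Fin d) ℝ}
    (h : ∀ i, frob (X i) ≤ c * frob (Y i)) : familyNorm X ≤ c * familyNorm Y := by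
  refine Real.sqrt_le_iff.2 ⟨mul_nonneg hc (familyNorm_nonneg Y), ?_⟩
  rw [familyNorm, mul_pow, Real.sq_sqrt (by positivity), mul_sum]
  refine sum_le_sum fun i _ => ?_
  rw [← mul_pow]
  exact pow_le_pow_left₀ (frob_nonneg _) (h i) 2

lemma familyNorm_sq (X : Fin n → Matrix (Fin d) (Fin d) ℝ) :
    familyNorm X ^ 2 = ∑ k, ∑ l, ∑ i, X i k l ^ 2 := by
  rw [familyNorm, Real.sq_sqrt (by positivity)]
  simp only [frob_sq]
  rw [sum_comm]
  exact sum_congr rfl fun k _ => sum_comm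

/-- An `ℓ²` bound on a matrix carries over to its action on families of matrices. -/
lemma familyNorm_mix_le {M : Matrix (Fin n) (Fin n) ℝ} {c : ℝ} (hc : 0 ≤ c)
    (hM : ∀ v : Fin n → ℝ, ∑ i, (M.mulVec v i) ^ 2 ≤ c ^ 2 * ∑ i, (v i) ^ 2)
    (X : Fin n → Matrix (Fin d) (Fin d) ℝ) : familyNorm (mix M X) ≤ c * familyNorm X := by
  refine le_of_sq_le_sq ?_ (mul_nonneg hc (familyNorm_nonneg X))
  rw [mul_pow, familyNorm_sq, familyNorm_sq]
  simp only [mul_sum]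
  refine sum_le_sum fun k _ => sum_le_sum fun l _ => ?_
  rw [← mul_sum]
  simpa [mix, Matrix.mulVec, dotProduct, Matrix.sum_apply] using hM fun j => X j k l

lemma sum_sq_mulVec_le_of_doublyStochastic {W : Matrix (Fin n) (Fin n) ℝ}
    (hnn : ∀ i j, 0 ≤ W i j) (hrow : ∀ i, ∑ j, W i j = 1) (hcol : ∀ j, ∑ i, W i j = 1)
    (v : Fin n → ℝ) : ∑ i, (W.mulVec v i) ^ 2 ≤ ∑ i, (v i) ^ 2 := by
  calc ∑ i, (W.mulVec v i) ^ 2 ≤ ∑ i, ∑ j, W i j * v j ^ 2 :=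
        sum_le_sum fun i _ => Real.pow_arith_mean_le_arith_mean_pow_of_even univ (W i) v
          (fun j _ => hnn i j) (hrow i) even_two
    _ = ∑ j, v j ^ 2 := by
        rw [sum_comm]
        simp only [← sum_mul, hcol, one_mul]

lemma sum_sq_sub_mean_le (hn : n ≠ 0) (v : Fin n → ℝ) :
    ∑ i, (v i - (n : ℝ)⁻¹ * ∑ j, v j) ^ 2 ≤ ∑ i, (v i) ^ 2 := by
  have hn' : (n : ℝ) ≠ 0 := Nat.cast_ne_zero.2 hn
  set m := (n : ℝ)⁻¹ * ∑ j, v j with hm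
  have hs : ∑ j, v j = n * m := by rw [hm, mul_inv_cancel_left₀ hn']
  have h : ∑ i, (v i - m) ^ 2 = ∑ i, (v i) ^ 2 - n * m ^ 2 := by
    simp only [sub_sq, sum_add_distrib, sum_sub_distrib, ← sum_mul, ← mul_sum, hs]
    simp only [sum_const, card_univ, Fintype.card_fin, nsmul_eq_mul]
    ring
  rw [h]
  exact sub_le_self _ (by positivity)

lemma familyNorm_sub_mean_le (hn : n ≠ 0) (X : Fin n → Matrix (Fin d) (Fin d) ℝ) :
    familyNorm (fun i => X i - (n : ℝ)⁻¹ • ∑ j, X j) ≤ familyNorm X := by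
  refine le_of_sq_le_sq ?_ (familyNorm_nonneg X)
  rw [familyNorm_sq, familyNorm_sq]
  refine sum_le_sum fun k _ => sum_le_sum fun l _ => ?_
  simpa [Matrix.sum_apply] using sum_sq_sub_mean_le hn fun j => X j k l

lemma sum_mix_of_col_sum {W : Matrix (Fin n) (Fin n) ℝ} (hcol : ∀ j, ∑ i, W i j = 1)
    (X : Fin n → Matrix (Fin d) (Fin d) ℝ) : ∑ i, mix W X i = ∑ i, X i := by
  simp only [mix]
  rw [sum_comm]
  simp only [← sum_smul, hcol, one_smul]

/-- On the deviations from the mean, a row-stochastic `W` minus the averaging matrix acts as `W`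
followed by removal of the mean. -/
lemma mix_sub_average_sub_mean (hn : n ≠ 0) {W P : Matrix (Fin n) (Fin n) ℝ}
    (hrow : ∀ i, ∑ j, W i j = 1) (hP : ∀ i j, P i j = 1 / (n : ℝ))
    (X : Fin n → Matrix (Fin d) (Fin d) ℝ) (i : Fin n) :
    mix (W - P) (fun j => X j - (n : ℝ)⁻¹ • ∑ k, X k) i
      = mix W X i - (n : ℝ)⁻¹ • ∑ k, X k := by
  have hn' : (n : ℝ) ≠ 0 := Nat.cast_ne_zero.2 hn
  simp only [mix, Matrix.sub_apply, hP, one_div, sub_smul, smul_sub, sum_sub_distrib, ← sum_smul,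
    ← smul_sum, hrow, one_smul]
  simp [hn']

/-- The error of a contractive compressor applied to `E + H - Ht`, measured around `H`. -/
lemma familyNorm_compression_error_le {δ : ℝ} (hδ0 : 0 ≤ δ) (hδ1 : δ ≤ 1)
    {Q : Matrix (Fin d) (Fin d) ℝ → Matrix (Fin d) (Fin d) ℝ}
    (hQ : ∀ A, frob (Q A - A) ≤ (1 - δ) * frob A)
    (E H Ht : Fin n → Matrix (Fin d) (Fin d) ℝ) :
    familyNorm (fun i => Ht i + Q (E i + H i - Ht i) - H i)
      ≤ 2 * familyNorm E + (1 - δ) * familyNorm (H - Ht) := by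
  have hsplit : (fun i => Ht i + Q (E i + H i - Ht i) - H i)
      = E + fun i => Q (E i + H i - Ht i) - (E i + H i - Ht i) := by
    funext i
    simp only [Pi.add_apply]
    abel
  have hres : familyNorm (fun i => Q (E i + H i - Ht i) - (E i + H i - Ht i))
      ≤ (1 - δ) * familyNorm (E + (H - Ht)) := by
    refine familyNorm_le_of_frob_le (sub_nonneg.2 hδ1) fun i => ?_
    simpa only [Pi.add_apply, Pi.sub_apply, add_sub_assoc] using hQ (E i + H i - Ht i)
  rw [hsplit]
  have hadd := familyNorm_add_le E fun i => Q (E i + H i - Ht i) - (E i + H i - Ht i)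
  have htri := mul_le_mul_of_nonneg_left (familyNorm_add_le E (H - Ht)) (sub_nonneg.2 hδ1)
  linarith [mul_nonneg hδ0 (familyNorm_nonneg E)]

end

/-- Lemma 8: recursion for the Hessian tracking (consensus) error. With
`Ĥᵢ = H̃ᵢ + Q(Eᵢ + Hᵢ - H̃ᵢ)` and `H'ᵢ = Hᵢ - γ(Ĥᵢ - ∑ⱼ Wᵢⱼ Ĥⱼ) + Δᵢ`,
`√(∑ᵢ‖H'ᵢ - H̄'‖_F²) ≤ (1 - γ(1-σ)) √(∑ᵢ‖Hᵢ - H̄‖_F²)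
  + 4γ √(∑ᵢ‖Eᵢ‖_F²) + 2γ(1-δ) √(∑ᵢ‖Hᵢ - H̃ᵢ‖_F²) + b`. -/
theorem stmt_10 (n d : ℕ) (hn : 1 ≤ n) (γ b δ σ : ℝ)
    (hγ0 : 0 ≤ γ) (hγ1 : γ ≤ 1) (hb : 0 ≤ b) (hδ0 : 0 < δ) (hδ1 : δ ≤ 1)
    (hσ : 0 ≤ σ)
    (W P : Matrix (Fin n) (Fin n) ℝ)
    (hWnn : ∀ i j, 0 ≤ W i j) (hWsymm : W.IsSymm) (hWrow : ∀ i, ∑ j, W i j = 1)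
    (hP : ∀ i j, P i j = 1 / (n : ℝ))
    (hσW : ∀ v : Fin n → ℝ,
      Real.sqrt (∑ i, ((W - P).mulVec v i) ^ 2) ≤ σ * Real.sqrt (∑ i, (v i) ^ 2))
    (Q : Matrix (Fin d) (Fin d) ℝ → Matrix (Fin d) (Fin d) ℝ)
    (hQ : ∀ A, frob (Q A - A) ≤ (1 - δ) * frob A)
    (E H Ht Δ Hhat H' : Fin n → Matrix (Fin d) (Fin d) ℝ)
    (hΔ : Real.sqrt (∑ i, (frob (Δ i)) ^ 2) ≤ b)
    (hHhat : ∀ i, Hhat i = Ht i + Q (E i + H i - Ht i))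
    (hH' : ∀ i, H' i = H i - γ • (Hhat i - ∑ j, W i j • Hhat j) + Δ i)
    (Hbar Hbar' : Matrix (Fin d) (Fin d) ℝ)
    (hHbar : Hbar = (n : ℝ)⁻¹ • ∑ j, H j)
    (hHbar' : Hbar' = (n : ℝ)⁻¹ • ∑ j, H' j) :
    Real.sqrt (∑ i, (frob (H' i - Hbar')) ^ 2) ≤
      (1 - γ * (1 - σ)) * Real.sqrt (∑ i, (frob (H i - Hbar)) ^ 2)
        + 4 * γ * Real.sqrt (∑ i, (frob (E i)) ^ 2)
        + 2 * γ * (1 - δ) * Real.sqrt (∑ i, (frob (H i - Ht i)) ^ 2) + b := by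
  have hn0 : n ≠ 0 := Nat.one_le_iff_ne_zero.1 hn
  have hcol : ∀ j, ∑ i, W i j = 1 := fun j => by
    rw [← hWrow j]
    exact sum_congr rfl fun i _ => hWsymm.apply j i
  let X : Fin n → Matrix (Fin d) (Fin d) ℝ := fun i => H i - (n : ℝ)⁻¹ • ∑ j, H j
  let e : Fin n → Matrix (Fin d) (Fin d) ℝ := Hhat - H
  let D : Fin n → Matrix (Fin d) (Fin d) ℝ := fun i => Δ i - (n : ℝ)⁻¹ • ∑ j, Δ j
  have hmean : ∑ i, H' i = ∑ i, H i + ∑ i, Δ i := by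
    have h := sum_mix_of_col_sum hcol Hhat
    simp only [mix] at h
    simp only [hH', sum_add_distrib, sum_sub_distrib, ← smul_sum, h, sub_self, smul_zero, sub_zero]
  have hdecomp : (fun i => H' i - Hbar')
      = ((1 - γ) • X + γ • mix (W - P) X) - γ • (e - mix W e) + D := by
    funext i
    have hX := mix_sub_average_sub_mean hn0 hWrow hP H i
    have he : mix W e i = mix W Hhat i - mix W H i := by
      simp [mix, e, smul_sub, sum_sub_distrib]
    simp only [Pi.add_apply, Pi.sub_apply, Pi.smul_apply, he]
    rw [show mix (W - P) X i = _ from hX, hHbar', hmean, hH']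
    simp only [mix, X, e, D, Pi.sub_apply]
    module
  have hX : familyNorm (mix (W - P) X) ≤ σ * familyNorm X := by
    refine familyNorm_mix_le hσ (fun v => ?_) X
    have h := pow_le_pow_left₀ (Real.sqrt_nonneg _) (hσW v) 2
    rwa [mul_pow, Real.sq_sqrt (by positivity), Real.sq_sqrt (by positivity)] at h
  have hWe : familyNorm (mix W e) ≤ familyNorm e := by
    simpa using familyNorm_mix_le zero_le_one
      (by simpa using sum_sq_mulVec_le_of_doublyStochastic hWnn hWrow hcol) e
  have he : familyNorm e ≤ 2 * familyNorm E + (1 - δ) * familyNorm (H - Ht) := by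
    convert familyNorm_compression_error_le hδ0.le hδ1 hQ E H Ht using 2
    funext i
    simp [e, hHhat]
  have hD : familyNorm D ≤ b := (familyNorm_sub_mean_le hn0 Δ).trans hΔ
  have hmain : familyNorm (fun i => H' i - Hbar')
      ≤ (1 - γ * (1 - σ)) * familyNorm X + 4 * γ * familyNorm E
        + 2 * γ * (1 - δ) * familyNorm (H - Ht) + b := by
    rw [hdecomp]
    calc _ ≤ (1 - γ) * familyNorm X + γ * familyNorm (mix (W - P) X)
          + γ * (familyNorm e + familyNorm (mix W e)) + familyNorm D := by
          refine (familyNorm_add_le _ _).trans (add_le_add_left ?_ _)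
          refine (familyNorm_sub_le _ _).trans (add_le_add ?_ ?_)
          · refine (familyNorm_add_le _ _).trans ?_
            rw [familyNorm_smul (sub_nonneg.2 hγ1), familyNorm_smul hγ0]
          · rw [familyNorm_smul hγ0]
            exact mul_le_mul_of_nonneg_left (familyNorm_sub_le _ _) hγ0
      _ ≤ (1 - γ) * familyNorm X + γ * (σ * familyNorm X)
          + γ * (2 * (2 * familyNorm E + (1 - δ) * familyNorm (H - Ht))) + b := by
          gcongr
          linarith
      _ = _ := by ring
  subst hHbar
  exact hmain
end
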